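/- arXiv:1410.3004 — 6 statements merged into one kernel-verified Lean document; each statement's English description precedes it below -/
import Mathlib

section
/- Let y : ℝ → (Fin n → ℝ) be differentiable and satisfy the fast subsystem ẏ_j(t) = ∑_{i,k} B j i k · y_i(t) · y_k(t) for all t ∈ ℝ and all j. Then the energy t ↦ ∑_j y_j(t)² is constant in t. -/
/-- The cubic form of a coefficient array whose cyclic sums vanish is zero. -/
theorem sum_mul_mul_mul_eq_zero_of_cyclic {ι : Type*} [Fintype ι]
    (B : ι → ι → ι → ℝ) (hB : ∀ i j k, B j i k + B i k j + B k j i = 0) (v : ι → ℝ) :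
    ∑ j, ∑ i, ∑ k, B j i k * v j * v i * v k = 0 := by
  have cyclic_shift (F : ι → ι → ι → ℝ) : ∑ j, ∑ i, ∑ k, F i k j = ∑ j, ∑ i, ∑ k, F j i k := by
    rw [Finset.sum_comm]
    exact Finset.sum_congr rfl fun i _ => Finset.sum_comm
  have h₁ := cyclic_shift fun j i k => B j i k * v j * v i * v k
  have h₂ := cyclic_shift fun j i k => B i k j * v i * v k * v j
  have h₀ : ∑ j, ∑ i, ∑ k, (B j i k * v j * v i * v k + B i k j * v i * v k * v j +
      B k j i * v k * v j * v i) = 0 :=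
    Finset.sum_eq_zero fun j _ => Finset.sum_eq_zero fun i _ => Finset.sum_eq_zero fun k _ => by
      linear_combination (v j * v i * v k) * hB i j k
  simp only [Finset.sum_add_distrib] at h₀
  linarith

/-- If `y` solves the fast subsystem
`ẏ_j = ∑_{i,k} B j i k · y_i y_k` with cyclic energy-conserving coefficients `B`,
then the energy `t ↦ ∑_j y_j(t)²` is constant. -/
theorem fast_subsystem_energy_conserved
    (n : ℕ) (hn : 1 ≤ n)
    (B : Fin n → Fin n → Fin n → ℝ)
    (hB : ∀ i j k, B j i k + B i k j + B k j i = 0)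
    (y : ℝ → Fin n → ℝ)
    (hy : ∀ t j, HasDerivAt (fun s => y s j)
      (∑ i, ∑ k, B j i k * y t i * y t k) t) :
    ∀ s t : ℝ, ∑ j, (y s j) ^ 2 = ∑ j, (y t j) ^ 2 := by
  have energy_deriv (t : ℝ) : HasDerivAt (fun s => ∑ j, (y s j) ^ 2) 0 t := by
    refine (HasDerivAt.fun_sum fun j _ => (hy t j).fun_pow 2).congr_deriv ?_
    calc _ = 2 * ∑ j, ∑ i, ∑ k, B j i k * y t j * y t i * y t k := by
          simp only [Finset.mul_sum]
          refine Finset.sum_congr rfl fun j _ => Finset.sum_congr rfl fun i _ =>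
            Finset.sum_congr rfl fun k _ => ?_
          push_cast
          ring
      _ = 0 := by rw [sum_mul_mul_mul_eq_zero_of_cyclic B hB, mul_zero]
  exact is_const_of_deriv_eq_zero (fun t => (energy_deriv t).differentiableAt)
    fun t => (energy_deriv t).deriv
end

section
/- Let g : ℝ → ℝ be differentiable and define F : ℝ × (Fin n → ℝ) → ℝ by F(x, y) = g(x² + ∑_j y_j²). Then F is annihilated by the coupling Fokker–Planck operator A₁: for all (x, y), ∑_{j,k} a j k · y_j y_k · ∂_x F(x,y) + x · ∑_{j,k} c j k · ∂_{y_j}( y_k F )(x,y) = 0, where ∂_{y_j}(y_k F) = δ_{jk} F + y_k ∂_{y_j} F. -/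
/-- A quadratic form vanishes if the symmetric part of its coefficient matrix does. -/
lemma sum_mul_mul_eq_zero_of_add_transpose_eq_zero {ι : Type*} [Fintype ι]
    {b : ι → ι → ℝ} (hb : ∀ j k, b j k + b k j = 0) (y : ι → ℝ) :
    ∑ j, ∑ k, b j k * y j * y k = 0 := by
  have hswap : ∑ j, ∑ k, b j k * y j * y k = ∑ j, ∑ k, b k j * y j * y k := by
    rw [Finset.sum_comm]
    exact Finset.sum_congr rfl fun j _ => Finset.sum_congr rfl fun k _ => by ring
  have hadd : ∑ j, ∑ k, b j k * y j * y k + ∑ j, ∑ k, b k j * y j * y k = 0 := by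
    simp only [← Finset.sum_add_distrib, ← add_mul, hb, zero_mul, Finset.sum_const_zero]
  linarith

/-- The partial derivatives of the sum of squares of the coordinates. -/
lemma hasDerivAt_sum_sq_update {ι : Type*} [Fintype ι] [DecidableEq ι] (y : ι → ℝ) (j : ι) :
    HasDerivAt (fun s => ∑ i, (Function.update y j s i) ^ 2) (2 * y j) (y j) := by
  have h : HasDerivAt (fun s : ℝ => s ^ 2 + ∑ i ∈ Finset.univ.erase j, y i ^ 2)
      (2 * y j) (y j) := by
    simpa using (hasDerivAt_pow 2 (y j)).add_const (∑ i ∈ Finset.univ.erase j, y i ^ 2)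
  convert h using 2 with s
  rw [← Finset.add_sum_erase _ _ (Finset.mem_univ j), Function.update_self]
  congr 1
  exact Finset.sum_congr rfl fun i hi => by
    rw [Function.update_of_ne (Finset.ne_of_mem_erase hi)]

/-- Any function `F(x,y) = g(x² + ∑_j y_j²)` of the total energy
is annihilated by the coupling Fokker–Planck operator
`A₁ = ∑_{j,k} a j k y_j y_k ∂_x + x ∑_{j,k} c j k ∂_{y_j}(y_k ·)`,
where `∂_{y_j}(y_k F) = δ_{jk} F + y_k ∂_{y_j} F`. -/
theorem energy_function_annihilated_by_coupling_operator
    (n : ℕ) (hn : 1 ≤ n)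
    (a c : Fin n → Fin n → ℝ)
    (hac : ∀ j k, a j k + a k j + c j k + c k j = 0)
    (ha0 : ∀ j, a j j = 0) (hc0 : ∀ j, c j j = 0)
    (g : ℝ → ℝ) (hg : Differentiable ℝ g)
    (F : ℝ → (Fin n → ℝ) → ℝ)
    (hF : ∀ x y, F x y = g (x ^ 2 + ∑ j, (y j) ^ 2)) :
    ∀ (x : ℝ) (y : Fin n → ℝ),
      (∑ j, ∑ k, a j k * y j * y k) * deriv (fun s => F s y) x
        + x * ∑ j, ∑ k, c j k *
            ((if j = k then F x y else 0)
              + y k * deriv (fun s => F x (Function.update y j s)) (y j)) = 0 := by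
  intro x y
  set D := deriv g (x ^ 2 + ∑ j, (y j) ^ 2) with hD
  have hx : deriv (fun s => F s y) x = D * (2 * x) := by
    have h : HasDerivAt (fun s : ℝ => s ^ 2 + ∑ j, (y j) ^ 2) (2 * x) x := by
      simpa using (hasDerivAt_pow 2 x).add_const (∑ j, (y j) ^ 2)
    simp only [hF]
    exact ((hg _).hasDerivAt.comp x h).deriv
  have hy (j : Fin n) :
      deriv (fun s => F x (Function.update y j s)) (y j) = D * (2 * y j) := by
    have h := (hasDerivAt_sum_sq_update y j).const_add (x ^ 2)
    simp only [hF]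
    have hgj : HasDerivAt g D (x ^ 2 + ∑ i, (Function.update y j (y j) i) ^ 2) := by
      rw [Function.update_eq_self]
      exact (hg _).hasDerivAt
    exact (hgj.comp (y j) h).deriv
  have hc (j k : Fin n) :
      c j k * ((if j = k then F x y else 0) + y k * (D * (2 * y j))) =
        2 * D * (c j k * y j * y k) := by
    split_ifs with hjk
    · subst hjk
      simp [hc0]
    · ring
  have hsum : ∑ j, ∑ k, (a j k + c j k) * y j * y k = 0 :=
    sum_mul_mul_eq_zero_of_add_transpose_eq_zero (fun j k => by linarith [hac j k]) y
  simp only [add_mul, Finset.sum_add_distrib] at hsum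
  simp only [hx, hy, hc, ← Finset.mul_sum]
  linear_combination 2 * D * x * hsum
end

section
/- Let g : ℝ → ℝ be differentiable and define G : (Fin n → ℝ) → ℝ by G(y) = g(∑_j y_j²). Then G is annihilated by the fast Fokker–Planck operator A₂: for all y, ∑_{i,j,k} B j i k · ∂_{y_j}( y_i y_k G )(y) = 0, where ∂_{y_j}(y_i y_k G) = δ_{ji} y_k G + δ_{jk} y_i G + y_i y_k ∂_{y_j} G. -/
/-- The partial derivative of a function of the energy `∑ l, y l ^ 2`. -/
theorem hasDerivAt_comp_sum_sq_update {ι : Type*} [Fintype ι] [DecidableEq ι] {g : ℝ → ℝ}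
    (y : ι → ℝ) (j : ι) (hg : DifferentiableAt ℝ g (∑ l, y l ^ 2)) :
    HasDerivAt (fun s => g (∑ l, Function.update y j s l ^ 2))
      (deriv g (∑ l, y l ^ 2) * (2 * y j)) (y j) := by
  have hsum : HasDerivAt (fun s => ∑ l, Function.update y j s l ^ 2) (2 * y j) (y j) := by
    have h := HasDerivAt.fun_sum (u := Finset.univ) fun l _ =>
      ((hasDerivAt_pi.1 (hasDerivAt_update y j (y j))) l).pow 2
    simpa [Pi.single_apply] using h
  have hg' : HasDerivAt g (deriv g (∑ l, y l ^ 2))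
      (∑ l, Function.update y j (y j) l ^ 2) := by
    simpa using hg.hasDerivAt
  exact hg'.comp (y j) hsum

/-- A trilinear form with vanishing cyclic sums vanishes on the diagonal. -/
theorem sum_mul_eq_zero_of_cyclic {ι : Type*} [Fintype ι] {B : ι → ι → ι → ℝ}
    (hB : ∀ i j k, B j i k + B i k j + B k j i = 0) (y : ι → ℝ) :
    ∑ i, ∑ j, ∑ k, B j i k * (y i * y j * y k) = 0 := by
  have h₁ : ∑ i, ∑ j, ∑ k, B i k j * (y i * y j * y k)
      = ∑ i, ∑ j, ∑ k, B j i k * (y i * y j * y k) := by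
    rw [Finset.sum_congr rfl fun i _ => Finset.sum_comm]
    rw [Finset.sum_comm]
    exact Finset.sum_congr rfl fun i _ => Finset.sum_congr rfl fun j _ =>
      Finset.sum_congr rfl fun k _ => by ring
  have h₂ : ∑ i, ∑ j, ∑ k, B k j i * (y i * y j * y k)
      = ∑ i, ∑ j, ∑ k, B j i k * (y i * y j * y k) := by
    rw [Finset.sum_comm]
    rw [Finset.sum_congr rfl fun i _ => Finset.sum_comm]
    exact Finset.sum_congr rfl fun i _ => Finset.sum_congr rfl fun j _ =>
      Finset.sum_congr rfl fun k _ => by ring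
  have h₃ : ∑ i, ∑ j, ∑ k, (B j i k + B i k j + B k j i) * (y i * y j * y k) = 0 := by
    simp [hB]
  simp only [add_mul, Finset.sum_add_distrib] at h₃
  linarith


/-- Any function `G(y) = g(∑_j y_j²)` of the fast energy is
annihilated by the fast Fokker–Planck operator
`A₂ = ∑_{i,j,k} B j i k ∂_{y_j}(y_i y_k ·)`, where
`∂_{y_j}(y_i y_k G) = δ_{ji} y_k G + δ_{jk} y_i G + y_i y_k ∂_{y_j} G`. -/
theorem energy_function_annihilated_by_fast_operator
    (n : ℕ) (hn : 1 ≤ n)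
    (B : Fin n → Fin n → Fin n → ℝ)
    (hB : ∀ i j k, B j i k + B i k j + B k j i = 0)
    (hB0 : ∀ j i k, j = i ∨ j = k ∨ i = k → B j i k = 0)
    (g : ℝ → ℝ) (hg : Differentiable ℝ g)
    (G : (Fin n → ℝ) → ℝ)
    (hG : ∀ y, G y = g (∑ j, (y j) ^ 2)) :
    ∀ y : Fin n → ℝ,
      ∑ i, ∑ j, ∑ k, B j i k *
        ((if j = i then y k * G y else 0)
          + (if j = k then y i * G y else 0)
          + y i * y k * deriv (fun s => G (Function.update y j s)) (y j)) = 0 := by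
  intro y
  have hderiv (j : Fin n) : deriv (fun s => G (Function.update y j s)) (y j)
      = deriv g (∑ l, y l ^ 2) * (2 * y j) := by
    simp only [hG]
    exact (hasDerivAt_comp_sum_sq_update y j (hg _)).deriv
  have hterm (i j k : Fin n) : B j i k *
        ((if j = i then y k * G y else 0)
          + (if j = k then y i * G y else 0)
          + y i * y k * deriv (fun s => G (Function.update y j s)) (y j))
      = 2 * deriv g (∑ l, y l ^ 2) * (B j i k * (y i * y j * y k)) := by
    rw [hderiv]
    by_cases hji : j = i
    · simp [hB0 j i k (Or.inl hji)]
    by_cases hjk : j = k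
    · simp [hB0 j i k (Or.inr (Or.inl hjk))]
    rw [if_neg hji, if_neg hjk]
    ring
  simp only [hterm, ← Finset.mul_sum, sum_mul_eq_zero_of_cyclic hB, mul_zero]
end

section
/- Let φ : ℝ → (Fin n → ℝ) → (Fin n → ℝ) be a global flow of the fast subsystem: φ_0(y) = y for all y, and for each y the curve τ ↦ φ_τ(y) is differentiable with ∂_τ φ_τ(y)_j = ∑_{i,k} B j i k · φ_τ(y)_i φ_τ(y)_k. For E > 0 let μ_E be the pushforward of the uniform probability measure on the unit sphere of EuclideanSpace ℝ (Fin n) under y ↦ √E • y, and define Q(E) = ∑_{j,k,j',k'} a j k · a j' k' · ∫₀^∞ ∫ y_j y_k · φ_τ(y)_{j'} φ_τ(y)_{k'} dμ_E(y) dτ, assuming the integrand is absolutely integrable on (0,∞) × sphere for the energy levels E and n. Then Q(E) = (E/n)^{3/2} · Q(n). -/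
open MeasureTheory

open Set in
/-- Forward uniqueness for an autonomous ODE with a continuously differentiable vector field. -/
theorem ContDiff.eq_of_hasDerivAt_of_nonneg {F : Type*} [NormedAddCommGroup F] [NormedSpace ℝ F]
    [FiniteDimensional ℝ F] {v : F → F} (hv : ContDiff ℝ 1 v) {f g : ℝ → F}
    (hf : ∀ t, HasDerivAt f (v (f t)) t) (hg : ∀ t, HasDerivAt g (v (g t)) t)
    (h0 : f 0 = g 0) {t : ℝ} (ht : 0 ≤ t) : f t = g t := by
  have hfc : Continuous f := continuous_iff_continuousAt.2 fun s => (hf s).continuousAt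
  have hgc : Continuous g := continuous_iff_continuousAt.2 fun s => (hg s).continuousAt
  have hK : IsCompact (f '' Icc 0 t ∪ g '' Icc 0 t) :=
    (isCompact_Icc.image hfc).union (isCompact_Icc.image hgc)
  obtain ⟨R, hR⟩ := hK.isBounded.subset_closedBall 0
  have := FiniteDimensional.proper ℝ F
  obtain ⟨K, hLip⟩ := hv.contDiffOn.exists_lipschitzOnWith one_ne_zero
    (convex_closedBall (0 : F) R) (isCompact_closedBall 0 R)
  refine ODE_solution_unique_of_mem_Icc_right (v := fun _ => v)
    (s := fun _ => Metric.closedBall (0 : F) R) (K := K) (a := 0) (b := t)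
    (fun _ _ => hLip) hfc.continuousOn (fun s _ => (hf s).hasDerivWithinAt)
    (fun s hs => hR (Or.inl (mem_image_of_mem f (Ico_subset_Icc_self hs))))
    hgc.continuousOn (fun s _ => (hg s).hasDerivWithinAt)
    (fun s hs => hR (Or.inr (mem_image_of_mem g (Ico_subset_Icc_self hs)))) h0
    (right_mem_Icc.2 ht)

/-- The scaling identity `φ_τ(c y) = c φ_{cτ}(y)` for the flow of a quadratic vector field. -/
theorem quadratic_flow_smul {ι : Type*} [Fintype ι] (B : ι → ι → ι → ℝ)
    (φ : ℝ → EuclideanSpace ℝ ι → EuclideanSpace ℝ ι)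
    (hφ0 : ∀ y, φ 0 y = y)
    (hflow : ∀ y τ j, HasDerivAt (fun s => φ s y j)
      (∑ i, ∑ k, B j i k * φ τ y i * φ τ y k) τ)
    (c : ℝ) (y : EuclideanSpace ℝ ι) {τ : ℝ} (hτ : 0 ≤ τ) :
    φ τ (c • y) = c • φ (c * τ) y := by
  let v : (ι → ℝ) → ι → ℝ := fun x j => ∑ i, ∑ k, B j i k * x i * x k
  have hv : ContDiff ℝ 1 v := by
    unfold v
    fun_prop
  have hf : ∀ t, HasDerivAt (fun s => (φ s (c • y)).ofLp) (v (φ t (c • y)).ofLp) t :=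
    fun t => hasDerivAt_pi.2 (hflow (c • y) t)
  have hg : ∀ t, HasDerivAt (fun s => c • (φ (c * s) y).ofLp) (v (c • (φ (c * t) y).ofLp)) t := by
    refine fun t => hasDerivAt_pi.2 fun j => ?_
    have h := ((hflow y (c * t) j).comp t ((hasDerivAt_id t).const_mul c)).const_mul c
    refine h.congr_deriv ?_
    simp only [v, Pi.smul_apply, smul_eq_mul, mul_one, Finset.mul_sum, Finset.sum_mul]
    exact Finset.sum_congr rfl fun i _ => Finset.sum_congr rfl fun k _ => by ring
  exact WithLp.ofLp_injective 2 <| hv.eq_of_hasDerivAt_of_nonneg hf hg (by simp [hφ0]) hτ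

/-- The integrated fourth moment on a sphere of radius `c` is `c ^ 3` times the one on the
original sphere. -/
theorem integral_fourth_moment_map_smul {ι : Type*} [Fintype ι]
    {φ : ℝ → EuclideanSpace ℝ ι → EuclideanSpace ℝ ι} {c : ℝ} (hc : 0 < c)
    (hφ : ∀ y τ, 0 ≤ τ → φ τ (c • y) = c • φ (c * τ) y)
    (μ : Measure (EuclideanSpace ℝ ι)) (j k j' k' : ι) :
    ∫ τ in Set.Ioi (0 : ℝ), ∫ y, y j * y k * φ τ y j' * φ τ y k' ∂(μ.map (fun y => c • y)) =
      c ^ 3 * ∫ τ in Set.Ioi (0 : ℝ), ∫ y, y j * y k * φ τ y j' * φ τ y k' ∂μ := by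
  have hinner : ∀ τ ∈ Set.Ioi (0 : ℝ),
      ∫ y, y j * y k * φ τ y j' * φ τ y k' ∂(μ.map (fun y => c • y)) =
        c ^ 4 * ∫ y, y j * y k * φ (c * τ) y j' * φ (c * τ) y k' ∂μ := by
    intro τ hτ
    rw [(measurableEmbedding_const_smul₀ hc.ne').integral_map, ← integral_const_mul]
    refine integral_congr_ae (.of_forall fun y => ?_)
    simp only [hφ y τ (le_of_lt hτ), PiLp.smul_apply, smul_eq_mul]
    ring
  rw [setIntegral_congr_fun measurableSet_Ioi hinner, integral_const_mul,
    integral_comp_mul_left_Ioi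
      (fun τ => ∫ y, y j * y k * φ τ y j' * φ τ y k' ∂μ) 0 hc, mul_zero, smul_eq_mul]
  field_simp

/-- Let `φ` be a global flow of the fast subsystem
`ẏ_j = ∑_{i,k} B j i k y_i y_k`, let `μ_E` be the uniform probability measure on
the sphere of energy `E` (pushforward of the uniform unit-sphere measure `μ₁`
under `y ↦ √E • y`), and let
`Q(E) = ∑_{j,k,j',k'} a j k a j' k' ∫₀^∞ ∫ y_j y_k φ_τ(y)_{j'} φ_τ(y)_{k'} dμ_E dτ`
(with the integrand absolutely integrable at energy levels `E` and `n`). Then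
`Q(E) = (E/n)^{3/2} · Q(n)`. -/
theorem integrated_fourth_moment_rescaling
    (n : ℕ) (hn : 1 ≤ n)
    (B : Fin n → Fin n → Fin n → ℝ)
    (a : Fin n → Fin n → ℝ)
    (φ : ℝ → EuclideanSpace ℝ (Fin n) → EuclideanSpace ℝ (Fin n))
    (hφ0 : ∀ y, φ 0 y = y)
    (hflow : ∀ y τ j, HasDerivAt (fun s => φ s y j)
      (∑ i, ∑ k, B j i k * φ τ y i * φ τ y k) τ)
    (μ₁ : Measure (EuclideanSpace ℝ (Fin n))) [IsProbabilityMeasure μ₁]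
    (hsupp : μ₁ {y : EuclideanSpace ℝ (Fin n) | ‖y‖ = 1} = 1)
    (hinv : ∀ R : EuclideanSpace ℝ (Fin n) ≃ₗᵢ[ℝ] EuclideanSpace ℝ (Fin n),
      μ₁.map R = μ₁)
    (E : ℝ) (hE : 0 < E)
    (hintegrable : ∀ E' ∈ ({E, (n : ℝ)} : Set ℝ), ∀ j k j' k' : Fin n,
      Integrable (fun p : ℝ × EuclideanSpace ℝ (Fin n) =>
          p.2 j * p.2 k * φ p.1 p.2 j' * φ p.1 p.2 k')
        ((volume.restrict (Set.Ioi (0 : ℝ))).prod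
          (μ₁.map (fun y => Real.sqrt E' • y))))
    (Q : ℝ → ℝ)
    (hQ : ∀ E' : ℝ, 0 < E' → Q E' = ∑ j, ∑ k, ∑ j', ∑ k', a j k * a j' k' *
      ∫ τ in Set.Ioi (0 : ℝ),
        ∫ y, y j * y k * φ τ y j' * φ τ y k'
          ∂(μ₁.map (fun y => Real.sqrt E' • y))) :
    Q E = (E / n) ^ ((3 : ℝ) / 2) * Q n := by
  have hscale : ∀ E' : ℝ, 0 < E' → Q E' = E' ^ ((3 : ℝ) / 2) *
      ∑ j, ∑ k, ∑ j', ∑ k', a j k * a j' k' *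
        ∫ τ in Set.Ioi (0 : ℝ), ∫ y, y j * y k * φ τ y j' * φ τ y k' ∂μ₁ := by
    intro E' hE'
    have hpow : E' ^ ((3 : ℝ) / 2) = √E' ^ 3 := by
      rw [Real.sqrt_eq_rpow, ← Real.rpow_natCast, ← Real.rpow_mul hE'.le]
      norm_num
    simp only [hQ E' hE', hpow, Finset.mul_sum,
      integral_fourth_moment_map_smul (Real.sqrt_pos.2 hE')
        (fun y _ => quadratic_flow_smul B φ hφ0 hflow √E' y), mul_left_comm]
  have hn0 : (0 : ℝ) < n := by exact_mod_cast hn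
  rw [hscale E hE, hscale n hn0, Real.div_rpow hE.le hn0.le, ← mul_assoc,
    div_mul_cancel₀ _ (Real.rpow_pos_of_pos hn0 _).ne']
end

section
/- Let n ≥ 1 be an integer and γ, σ, M > 0. Define on ℝ × (0,∞) the density ρ(x,E) = exp(−γ x²/σ²) · E^{(n−2)/2} · exp(−γ E/σ²), the drift coefficients b_x(x,E) = −γ x − (n+1) M x E^{1/2} n^{−3/2} and b_E(x,E) = −2 M (E/n)^{3/2} + 2 (n+1) M x² E^{1/2} n^{−3/2}, and the diffusion coefficients a_{xx}(x,E) = σ² + 2M (E/n)^{3/2}, a_{xE}(x,E) = −4 M x (E/n)^{3/2}, a_{EE}(x,E) = 8 M x² (E/n)^{3/2}. Then ρ is a stationary solution of the Fokker–Planck equation of the reduced model: for all x ∈ ℝ and E > 0, −∂_x( b_x ρ ) − ∂_E( b_E ρ ) + (1/2) ∂_{xx}( a_{xx} ρ ) + ∂_x ∂_E( a_{xE} ρ ) + (1/2) ∂_{EE}( a_{EE} ρ ) = 0. -/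
/-- The derivative of `E ↦ E ^ a e^{−γE/σ²}` away from the origin. -/
lemma hasDerivAt_rpow_mul_exp (a γ σ : ℝ) {E : ℝ} (hE : 0 < E) :
    HasDerivAt (fun s : ℝ => s ^ a * Real.exp (-(γ * s) / σ ^ 2))
      (a * (E ^ (a - 1) * Real.exp (-(γ * E) / σ ^ 2))
        - γ / σ ^ 2 * (E ^ a * Real.exp (-(γ * E) / σ ^ 2))) E := by
  have h1 := Real.hasDerivAt_rpow_const (p := a) (Or.inl hE.ne')
  have h2 : HasDerivAt (fun s : ℝ => -(γ * s) / σ ^ 2) (-(γ * 1) / σ ^ 2) E :=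
    (((hasDerivAt_id E).const_mul γ).neg).div_const _
  exact (h1.mul h2.exp).congr_deriv (by ring)

/-- The derivative of the Gaussian `x ↦ e^{−γx²/σ²}`. -/
lemma hasDerivAt_exp_neg_mul_sq_div (γ σ x : ℝ) :
    HasDerivAt (fun u : ℝ => Real.exp (-(γ * u ^ 2) / σ ^ 2))
      (-(2 * (γ / σ ^ 2) * x * Real.exp (-(γ * x ^ 2) / σ ^ 2))) x := by
  have h : HasDerivAt (fun u : ℝ => -(γ * u ^ 2) / σ ^ 2) (-(γ * (2 * x)) / σ ^ 2) x := by
    simpa using (((hasDerivAt_pow 2 x).const_mul γ).neg).div_const (σ ^ 2)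
  exact h.exp.congr_deriv (by ring)

/-- The derivative of `x ↦ x e^{−γx²/σ²}`. -/
lemma hasDerivAt_mul_exp_neg_mul_sq_div (γ σ x : ℝ) :
    HasDerivAt (fun u : ℝ => u * Real.exp (-(γ * u ^ 2) / σ ^ 2))
      (Real.exp (-(γ * x ^ 2) / σ ^ 2)
        - 2 * (γ / σ ^ 2) * x ^ 2 * Real.exp (-(γ * x ^ 2) / σ ^ 2)) x :=
  ((hasDerivAt_id x).mul (hasDerivAt_exp_neg_mul_sq_div γ σ x)).congr_deriv (by simp; ring)

/-- The density `ρ(x,E) = e^{−γx²/σ²} E^{(n−2)/2} e^{−γE/σ²}`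
is a stationary solution of the Fokker–Planck equation of the reduced model:
`−∂_x(b_x ρ) − ∂_E(b_E ρ) + ½∂_{xx}(a_{xx}ρ) + ∂_x∂_E(a_{xE}ρ) + ½∂_{EE}(a_{EE}ρ) = 0`. -/
theorem reduced_model_stationary_FokkerPlanck
    (n : ℕ) (hn : 1 ≤ n) (γ σ M : ℝ) (hγ : 0 < γ) (hσ : 0 < σ) (hM : 0 < M)
    (ρ bx bE axx axE aEE : ℝ → ℝ → ℝ)
    (hρ : ∀ x E, ρ x E = Real.exp (-(γ * x ^ 2) / σ ^ 2)
      * E ^ (((n : ℝ) - 2) / 2) * Real.exp (-(γ * E) / σ ^ 2))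
    (hbx : ∀ x E, bx x E = -(γ * x)
      - ((n : ℝ) + 1) * M * x * E ^ ((1 : ℝ) / 2) * (n : ℝ) ^ (-(3 : ℝ) / 2))
    (hbE : ∀ x E, bE x E = -2 * M * (E / n) ^ ((3 : ℝ) / 2)
      + 2 * ((n : ℝ) + 1) * M * x ^ 2 * E ^ ((1 : ℝ) / 2) * (n : ℝ) ^ (-(3 : ℝ) / 2))
    (haxx : ∀ x E, axx x E = σ ^ 2 + 2 * M * (E / n) ^ ((3 : ℝ) / 2))
    (haxE : ∀ x E, axE x E = -4 * M * x * (E / n) ^ ((3 : ℝ) / 2))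
    (haEE : ∀ x E, aEE x E = 8 * M * x ^ 2 * (E / n) ^ ((3 : ℝ) / 2)) :
    ∀ (x E : ℝ), 0 < E →
      -deriv (fun s => bx s E * ρ s E) x
        - deriv (fun s => bE x s * ρ x s) E
        + (1 / 2) * deriv (fun s => deriv (fun u => axx u E * ρ u E) s) x
        + deriv (fun u => deriv (fun s => axE u s * ρ u s) E) x
        + (1 / 2) * deriv (fun s => deriv (fun u => aEE x u * ρ x u) s) E = 0 := by
  intro x E hE
  set k : ℝ := (n : ℝ) ^ (-(3 : ℝ) / 2) with hk
  set g : ℝ → ℝ := fun u => Real.exp (-(γ * u ^ 2) / σ ^ 2) with hg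
  set R : ℝ → ℝ := fun s => s ^ (((n : ℝ) - 2) / 2) * Real.exp (-(γ * s) / σ ^ 2) with hR
  set Q : ℝ → ℝ := fun s => s ^ (((n : ℝ) - 1) / 2) * Real.exp (-(γ * s) / σ ^ 2) with hQ
  set P : ℝ → ℝ := fun s => s ^ (((n : ℝ) + 1) / 2) * Real.exp (-(γ * s) / σ ^ 2) with hP
  have hP' : ∀ s, 0 < s → HasDerivAt P (((n : ℝ) + 1) / 2 * Q s - γ / σ ^ 2 * P s) s := by
    intro s hs
    have h := hasDerivAt_rpow_mul_exp (((n : ℝ) + 1) / 2) γ σ hs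
    rwa [show ((n : ℝ) + 1) / 2 - 1 = ((n : ℝ) - 1) / 2 by ring] at h
  obtain ⟨Q', hQ'⟩ : ∃ Q', HasDerivAt Q Q' E := ⟨_, hasDerivAt_rpow_mul_exp _ γ σ hE⟩
  have hg' : ∀ u, HasDerivAt g (-(2 * (γ / σ ^ 2) * u * g u)) u :=
    hasDerivAt_exp_neg_mul_sq_div γ σ
  have hxg' : ∀ u, HasDerivAt (fun u => u * g u) (g u - 2 * (γ / σ ^ 2) * u ^ 2 * g u) u :=
    hasDerivAt_mul_exp_neg_mul_sq_div γ σ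
  have hρ' : ∀ u s, ρ u s = g u * R s := fun u s => by rw [hρ, mul_assoc]
  have hhalf : ∀ s, 0 < s → s ^ ((1 : ℝ) / 2) * R s = Q s := by
    intro s hs
    simp only [hR, hQ]
    rw [← mul_assoc, ← Real.rpow_add hs]
    congr 2
    ring
  have hthree : ∀ s, 0 < s → (s / n) ^ ((3 : ℝ) / 2) * R s = k * P s := by
    intro s hs
    simp only [hR, hP]
    rw [Real.div_rpow hs.le n.cast_nonneg, hk, neg_div (2 : ℝ) 3, Real.rpow_neg n.cast_nonneg,
      show ((n : ℝ) + 1) / 2 = 3 / 2 + ((n : ℝ) - 2) / 2 by ring, Real.rpow_add hs]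
    ring
  have hnhds : ∀ s : ℝ, 0 < s → ∀ᶠ t in nhds s, 0 < t := fun s hs => lt_mem_nhds hs
  have drift_x : deriv (fun s => bx s E * ρ s E) x
      = (-γ * R E - ((n : ℝ) + 1) * M * k * Q E) * (g x - 2 * (γ / σ ^ 2) * x ^ 2 * g x) := by
    have h : (fun s => bx s E * ρ s E)
        = fun s => (-γ * R E - ((n : ℝ) + 1) * M * k * Q E) * (s * g s) := by
      funext s
      rw [hbx, hρ', ← hhalf E hE]
      ring
    rw [h]
    exact ((hxg' x).const_mul _).deriv
  have drift_E : deriv (fun s => bE x s * ρ x s) E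
      = -2 * M * k * g x * (((n : ℝ) + 1) / 2 * Q E - γ / σ ^ 2 * P E)
        + 2 * ((n : ℝ) + 1) * M * k * x ^ 2 * g x * Q' := by
    refine HasDerivAt.deriv (HasDerivAt.congr_of_eventuallyEq
      (((hP' E hE).const_mul (-2 * M * k * g x)).add
        (hQ'.const_mul (2 * ((n : ℝ) + 1) * M * k * x ^ 2 * g x))) ?_)
    filter_upwards [hnhds E hE] with s hs
    simp only [Pi.add_apply]
    rw [hbE, hρ', ← hhalf s hs]
    linear_combination (-2 * M * g x) * hthree s hs
  have diffusion_xx : deriv (fun s => deriv (fun u => axx u E * ρ u E) s) x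
      = (σ ^ 2 * R E + 2 * M * k * P E)
        * (-(2 * (γ / σ ^ 2)) * (g x - 2 * (γ / σ ^ 2) * x ^ 2 * g x)) := by
    have h : (fun u => axx u E * ρ u E)
        = fun u => (σ ^ 2 * R E + 2 * M * k * P E) * g u := by
      funext u
      rw [haxx, hρ']
      linear_combination (2 * M * g u) * hthree E hE
    have h' : (fun s => deriv (fun u => axx u E * ρ u E) s)
        = fun s => (σ ^ 2 * R E + 2 * M * k * P E) * (-(2 * (γ / σ ^ 2)) * (s * g s)) := by
      funext s
      rw [h, ((hg' s).const_mul _).deriv]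
      ring
    rw [h']
    exact (((hxg' x).const_mul _).const_mul _).deriv
  have diffusion_xE : deriv (fun u => deriv (fun s => axE u s * ρ u s) E) x
      = -4 * M * k * (((n : ℝ) + 1) / 2 * Q E - γ / σ ^ 2 * P E)
        * (g x - 2 * (γ / σ ^ 2) * x ^ 2 * g x) := by
    have h : (fun u => deriv (fun s => axE u s * ρ u s) E)
        = fun u => -4 * M * k * (((n : ℝ) + 1) / 2 * Q E - γ / σ ^ 2 * P E) * (u * g u) := by
      funext u
      have h' := (HasDerivAt.congr_of_eventuallyEq
        (f₁ := fun s => axE u s * ρ u s) ((hP' E hE).const_mul (-4 * M * k * (u * g u))) (by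
          filter_upwards [hnhds E hE] with s hs
          rw [haxE, hρ']
          linear_combination (-4 * M * u * g u) * hthree s hs)).deriv
      rw [h']
      ring
    rw [h]
    exact ((hxg' x).const_mul _).deriv
  have diffusion_EE : deriv (fun s => deriv (fun u => aEE x u * ρ x u) s) E
      = 8 * M * k * x ^ 2 * g x * (((n : ℝ) + 1) / 2 * Q'
        - γ / σ ^ 2 * (((n : ℝ) + 1) / 2 * Q E - γ / σ ^ 2 * P E)) := by
    refine HasDerivAt.deriv (HasDerivAt.congr_of_eventuallyEq
      (((hQ'.const_mul (((n : ℝ) + 1) / 2)).sub ((hP' E hE).const_mul (γ / σ ^ 2))).const_mul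
        (8 * M * k * x ^ 2 * g x)) ?_)
    filter_upwards [hnhds E hE] with s hs
    refine HasDerivAt.deriv (HasDerivAt.congr_of_eventuallyEq
      ((hP' s hs).const_mul (8 * M * k * x ^ 2 * g x)) ?_)
    filter_upwards [hnhds s hs] with t ht
    rw [haEE, hρ']
    linear_combination (8 * M * x ^ 2 * g x) * hthree t ht
  rw [drift_x, drift_E, diffusion_xx, diffusion_xE, diffusion_EE]
  field_simp
  ring
end

section
/- Let n ≥ 1 be an integer, M ∈ ℝ, and let g : ℝ → ℝ be twice differentiable. Define u(x,E) = g(x² + E) on ℝ × (0,∞). Then the reduced backward operator L annihilates u: for all x ∈ ℝ and E > 0, −(E^{1/2}/n^{3/2}) M [ (n+1) x ∂_x u + 2E ∂_E u − 2 x² (n+1) ∂_E u ] + (E^{3/2}/n^{3/2}) M [ ∂_{xx} u − 2x ∂_{xE} u − 2x ∂_{Ex} u + 4x² ∂_{EE} u ] = 0. -/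
theorem deriv_comp_sq_add {f : ℝ → ℝ} (hf : Differentiable ℝ f) (x E : ℝ) :
    deriv (fun s => f (s ^ 2 + E)) x = 2 * x * deriv f (x ^ 2 + E) := by
  have h : HasDerivAt (fun s : ℝ => s ^ 2 + E) (2 * x) x := by
    simpa using (hasDerivAt_pow 2 x).add_const E
  exact ((hf _).hasDerivAt.comp x h).deriv.trans (mul_comm _ _)

theorem deriv_mul_comp_sq_add {f : ℝ → ℝ} (hf : Differentiable ℝ f) (x E : ℝ) :
    deriv (fun s => 2 * s * f (s ^ 2 + E)) x =
      2 * f (x ^ 2 + E) + 4 * x ^ 2 * deriv f (x ^ 2 + E) := by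
  rw [deriv_fun_mul (by fun_prop) (by fun_prop), deriv_comp_sq_add hf, deriv_const_mul_field, deriv_id'']
  ring

/-- Any function `u(x,E) = g(x² + E)` of the total energy is
annihilated by the reduced backward operator
`L = −(E^{1/2}/n^{3/2}) M ((n+1)x∂_x + 2E∂_E − 2x²(n+1)∂_E)
   + (E^{3/2}/n^{3/2}) M (∂_{xx} − 2x∂_{xE} − 2x∂_{Ex} + 4x²∂_{EE})`. -/
theorem reduced_operator_annihilates_energy_function
    (n : ℕ) (hn : 1 ≤ n) (M : ℝ)
    (g : ℝ → ℝ) (hg : Differentiable ℝ g) (hg' : Differentiable ℝ (deriv g))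
    (u : ℝ → ℝ → ℝ)
    (hu : ∀ x E, u x E = g (x ^ 2 + E)) :
    ∀ (x E : ℝ), 0 < E →
      -(E ^ ((1 : ℝ) / 2) / (n : ℝ) ^ ((3 : ℝ) / 2)) * M *
          (((n : ℝ) + 1) * x * deriv (fun s => u s E) x
            + 2 * E * deriv (fun s => u x s) E
            - 2 * x ^ 2 * ((n : ℝ) + 1) * deriv (fun s => u x s) E)
        + (E ^ ((3 : ℝ) / 2) / (n : ℝ) ^ ((3 : ℝ) / 2)) * M *
          (deriv (fun s => deriv (fun t => u t E) s) x
            - 2 * x * deriv (fun s => deriv (fun t => u s t) E) x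
            - 2 * x * deriv (fun s => deriv (fun t => u t s) x) E
            + 4 * x ^ 2 * deriv (fun s => deriv (fun t => u x t) s) E) = 0 := by
  intro x E hE
  obtain rfl : u = fun x E => g (x ^ 2 + E) := funext₂ hu
  have hpow : E ^ ((3 : ℝ) / 2) = E ^ ((1 : ℝ) / 2) * E := by
    rw [← Real.rpow_add_one hE.ne']
    norm_num
  simp only [deriv_comp_sq_add hg, deriv_comp_sq_add hg', deriv_comp_const_add,
    deriv_mul_comp_sq_add hg', deriv_const_mul_field, hpow]
  ring
end
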